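/- arXiv:1704.00590 — 9 statements merged into one kernel-verified Lean document; each statement's English description precedes it below -/
import Mathlib

section
/- Let (X,G) be a G-complete G-metric space and let T : X → X be a G-continuous mapping such that there exists λ ∈ [0,1) with the property: for each x ∈ X there exists a positive integer n(x) such that G(T^{n(x)} x, T^{n(x)} y, T^{n(x)} z) ≤ λ · G(x, y, z) for all y, z ∈ X. Then T has exactly one fixed point in X. -/
/-- A G-metric on a set `X`: a function `G : X × X × X → [0,∞)` satisfying
(G1) `G x x x = 0`; (G2) `G x x y > 0` for `x ≠ y`; (G3) `G x x y ≤ G x y z` for `z ≠ y`;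
(G4) symmetry in all three variables; (G5) `G x y z ≤ G x a a + G a y z`. -/
def IsGMetric {X : Type*} (G : X → X → X → ℝ) : Prop :=
  (∀ x y z, 0 ≤ G x y z) ∧
  (∀ x, G x x x = 0) ∧
  (∀ x y, x ≠ y → 0 < G x x y) ∧
  (∀ x y z, z ≠ y → G x x y ≤ G x y z) ∧
  (∀ x y z, G x y z = G x z y) ∧
  (∀ x y z, G x y z = G y z x) ∧
  (∀ x y z a, G x y z ≤ G x a a + G a y z)

/-- A sequence `s` G-converges to `x` iff `G x (s n) (s n) → 0`. -/
def GConvergesTo {X : Type*} (G : X → X → X → ℝ) (s : ℕ → X) (x : X) : Prop :=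
  Filter.Tendsto (fun n => G x (s n) (s n)) Filter.atTop (nhds 0)

/-- A sequence `s` is G-Cauchy iff for every `ε > 0` there is `N` with
`G (s n) (s m) (s m) < ε` for all `m, n ≥ N`. -/
def IsGCauchy {X : Type*} (G : X → X → X → ℝ) (s : ℕ → X) : Prop :=
  ∀ ε > (0 : ℝ), ∃ N : ℕ, ∀ m ≥ N, ∀ n ≥ N, G (s n) (s m) (s m) < ε

/-- `(X, G)` is G-complete iff every G-Cauchy sequence G-converges to some point. -/
def IsGComplete {X : Type*} (G : X → X → X → ℝ) : Prop :=
  ∀ s : ℕ → X, IsGCauchy G s → ∃ x, GConvergesTo G s x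

/-- `T` is G-continuous iff it maps G-convergent sequences to G-convergent sequences. -/
def IsGContinuous {X : Type*} (G : X → X → X → ℝ) (T : X → X) : Prop :=
  ∀ (s : ℕ → X) (x : X), GConvergesTo G s x → GConvergesTo G (fun n => T (s n)) (T x)

namespace IsGMetric

variable {X : Type*} {G : X → X → X → ℝ}

theorem nonneg (hG : IsGMetric G) (x y z : X) : 0 ≤ G x y z := hG.1 x y z

theorem triangle (hG : IsGMetric G) (x y z : X) : G x z z ≤ G x y y + G y z z :=
  hG.2.2.2.2.2.2 x z z y

theorem swap_le (hG : IsGMetric G) (x y : X) : G y x x ≤ 2 * G x y y := by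
  obtain ⟨-, -, -, -, -, hrot, htri⟩ := hG
  have h₁ := htri x x y y
  have h₂ := hrot y x x
  have h₃ := hrot y x y
  have h₄ := hrot x y y
  linarith

theorem eq_of_nonpos (hG : IsGMetric G) {x y : X} (hxy : G x y y ≤ 0) : x = y := by
  by_contra hne
  have h₁ := hG.2.2.1 y x (Ne.symm hne)
  have h₂ := hG.2.2.2.2.2.1 x y y
  linarith

end IsGMetric

section PowerContraction

variable {X : Type*} {G : X → X → X → ℝ} {T : X → X} {lam : ℝ}

/-- If some iterate of `T` contracts distances from `x`, the `T`-orbit of `x` is bounded. -/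
theorem IsGMetric.exists_orbit_bound (hG : IsGMetric G) (hlam0 : 0 ≤ lam) (hlam1 : lam < 1)
    {x : X} {n : ℕ} (hn : 0 < n)
    (hx : ∀ y, G (T^[n] x) (T^[n] y) (T^[n] y) ≤ lam * G x y y) :
    ∃ r, ∀ k, G x (T^[k] x) (T^[k] x) ≤ r := by
  set M := ∑ k ∈ Finset.range (n + 1), G x (T^[k] x) (T^[k] x) with hM
  have hle : ∀ k ≤ n, G x (T^[k] x) (T^[k] x) ≤ M := fun k hk =>
    Finset.single_le_sum (f := fun k => G x (T^[k] x) (T^[k] x))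
      (fun _ _ => hG.nonneg _ _ _) (Finset.mem_range.2 (Nat.lt_succ_of_le hk))
  have hM0 : 0 ≤ M := (hG.nonneg _ _ _).trans (hle 0 n.zero_le)
  have hfix : M + lam * (M / (1 - lam)) = M / (1 - lam) := by
    have : 1 - lam ≠ 0 := by linarith
    field_simp
    ring
  have hbound0 : 0 ≤ M / (1 - lam) := div_nonneg hM0 (by linarith)
  refine ⟨M / (1 - lam), fun k => ?_⟩
  induction k using Nat.strong_induction_on with
  | _ k ih =>
    rcases le_total k n with hk | hk
    · have := mul_nonneg hlam0 hbound0
      linarith [hle k hk]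
    · obtain ⟨j, rfl⟩ := Nat.exists_eq_add_of_le hk
      rw [Function.iterate_add_apply]
      have h₁ := hG.triangle x (T^[n] x) (T^[n] (T^[j] x))
      have h₂ := hx (T^[j] x)
      have h₃ := mul_le_mul_of_nonneg_left (ih j (by omega)) hlam0
      linarith [hle n le_rfl]

variable {N : X → ℕ} {s : ℕ → X}

theorem exists_iterate_eq_of_le (hs : ∀ i, s (i + 1) = T^[N (s i)] (s i)) {i j : ℕ}
    (hij : i ≤ j) : ∃ k, s j = T^[k] (s i) := by
  induction j, hij using Nat.le_induction with
  | base => exact ⟨0, rfl⟩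
  | succ j _ ih =>
    obtain ⟨k, hk⟩ := ih
    exact ⟨N (s j) + k, by rw [hs j, Function.iterate_add_apply, ← hk]⟩

theorem dist_iterate_le_pow_mul (hlam0 : 0 ≤ lam)
    (hN : ∀ x y, G (T^[N x] x) (T^[N x] y) (T^[N x] y) ≤ lam * G x y y)
    (hs : ∀ i, s (i + 1) = T^[N (s i)] (s i)) (i k : ℕ) :
    G (s i) (T^[k] (s i)) (T^[k] (s i)) ≤
      lam ^ i * G (s 0) (T^[k] (s 0)) (T^[k] (s 0)) := by
  induction i with
  | zero => simp
  | succ i ih =>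
    have hcomm : T^[k] (T^[N (s i)] (s i)) = T^[N (s i)] (T^[k] (s i)) :=
      (Function.Commute.refl T).iterate_iterate k (N (s i)) (s i)
    rw [hs i, hcomm, pow_succ', mul_assoc]
    exact (hN _ _).trans (mul_le_mul_of_nonneg_left ih hlam0)

theorem IsGMetric.isGCauchy_of_dist_iterate_le (hG : IsGMetric G)
    (hs : ∀ i, s (i + 1) = T^[N (s i)] (s i)) {b : ℕ → ℝ}
    (hb : Filter.Tendsto b Filter.atTop (nhds 0))
    (hsb : ∀ i k, G (s i) (T^[k] (s i)) (T^[k] (s i)) ≤ b i) : IsGCauchy G s := by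
  intro ε hε
  obtain ⟨i, hi⟩ := (hb.eventually_lt_const (show (0 : ℝ) < ε / 3 by positivity)).exists
  have hle : ∀ j ≥ i, G (s i) (s j) (s j) ≤ b i := by
    intro j hj
    obtain ⟨k, hk⟩ := exists_iterate_eq_of_le hs hj
    exact hk ▸ hsb i k
  refine ⟨i, fun m hm n hn => ?_⟩
  linarith [hG.triangle (s n) (s i) (s m), hG.swap_le (s i) (s n), hle m hm, hle n hn]

theorem IsGMetric.isFixedPt_of_gConvergesTo (hG : IsGMetric G) (hT : IsGContinuous G T) {u : X}
    (hu : GConvergesTo G s u)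
    (hsT : Filter.Tendsto (fun i => G (s i) (T (s i)) (T (s i))) Filter.atTop (nhds 0)) :
    T u = u := by
  have hlim := (Filter.Tendsto.add hu hsT).add ((hT s u hu).const_mul 2)
  rw [add_zero, mul_zero, add_zero] at hlim
  refine (hG.eq_of_nonpos (ge_of_tendsto' hlim fun i => ?_)).symm
  linarith [hG.triangle u (s i) (T u), hG.triangle (s i) (T (s i)) (T u),
    hG.swap_le (T u) (T (s i))]

end PowerContraction

/-- **Theorem (power-contraction BCP in G-metric spaces).**
If `(X,G)` is a G-complete G-metric space and `T` is G-continuous, and there is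
`λ ∈ [0,1)` such that for each `x` there is a positive integer `n(x)` with
`G(T^[n x] x, T^[n x] y, T^[n x] z) ≤ λ · G(x,y,z)` for all `y, z`, then `T` has
exactly one fixed point. -/
theorem gmetric_power_contraction_fixed_point {X : Type*} [Nonempty X]
    (G : X → X → X → ℝ) (hG : IsGMetric G) (hcomp : IsGComplete G)
    (T : X → X) (hT : IsGContinuous G T)
    (lam : ℝ) (hlam0 : 0 ≤ lam) (hlam1 : lam < 1)
    (h : ∀ x : X, ∃ n : ℕ, 0 < n ∧
      ∀ y z : X, G (T^[n] x) (T^[n] y) (T^[n] z) ≤ lam * G x y z) :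
    ∃! ξ : X, T ξ = ξ := by
  choose N hN0 hN using h
  have hN' : ∀ x y, G (T^[N x] x) (T^[N x] y) (T^[N x] y) ≤ lam * G x y y :=
    fun x y => hN x y y
  obtain ⟨x⟩ := ‹Nonempty X›
  let s : ℕ → X := fun i => (fun y => T^[N y] y)^[i] x
  have hs : ∀ i, s (i + 1) = T^[N (s i)] (s i) := fun i =>
    Function.iterate_succ_apply' _ i x
  obtain ⟨r, hr⟩ := hG.exists_orbit_bound hlam0 hlam1 (hN0 x) (hN' x)
  have hsr : ∀ i k, G (s i) (T^[k] (s i)) (T^[k] (s i)) ≤ lam ^ i * r := fun i k =>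
    (dist_iterate_le_pow_mul hlam0 hN' hs i k).trans
      (mul_le_mul_of_nonneg_left (hr k) (pow_nonneg hlam0 i))
  have hlim : Filter.Tendsto (fun i : ℕ => lam ^ i * r) Filter.atTop (nhds 0) := by
    simpa using (tendsto_pow_atTop_nhds_zero_of_lt_one hlam0 hlam1).mul_const r
  obtain ⟨u, hu⟩ := hcomp s (hG.isGCauchy_of_dist_iterate_le hs hlim hsr)
  have hfix : T u = u := hG.isFixedPt_of_gConvergesTo hT hu
    (squeeze_zero (fun _ => hG.nonneg _ _ _) (fun i => hsr i 1) hlim)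
  refine ⟨u, hfix, fun v hv => (hG.eq_of_nonpos ?_).symm⟩
  have hle := hN' u v
  rw [Function.iterate_fixed hfix, Function.iterate_fixed hv] at hle
  nlinarith
end

section
/- Let (X,G) be a G-metric space and let T : X → X be a mapping such that there exists λ ∈ [0,1) with the property: for each x ∈ X there exists a positive integer n(x) such that G(T^{n(x)} x, T^{n(x)} y, T^{n(x)} z) ≤ λ · G(x, y, z) for all y, z ∈ X. Then for every x ∈ X, the quantity r(x) = sup_{n ≥ 1} G(x, T^n x, T^n x) is finite; in fact r(x) ≤ l(x)/(1−λ), where l(x) = max{ G(x, T^i x, T^i x) : i = 1, 2, …, n(x) }. -/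
/-- **Lemma.** Under the power-contraction condition, for every `x` the quantity
`r(x) = sup_{m ≥ 1} G(x, T^m x, T^m x)` is finite: indeed, whenever `n = n(x)` is a
positive integer witnessing the contraction condition at `x`, every value
`G(x, T^m x, T^m x)` (for `m ≥ 1`) is bounded by `l(x)/(1-λ)`, where
`l(x) = max { G(x, T^i x, T^i x) : i = 1, …, n }`. -/
theorem gmetric_power_contraction_r_finite {X : Type*}
    (G : X → X → X → ℝ) (hG : IsGMetric G)
    (T : X → X) (lam : ℝ) (hlam0 : 0 ≤ lam) (hlam1 : lam < 1)
    (h : ∀ x : X, ∃ n : ℕ, 0 < n ∧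
      ∀ y z : X, G (T^[n] x) (T^[n] y) (T^[n] z) ≤ lam * G x y z)
    (x : X) (n : ℕ) (hn : 0 < n)
    (hnx : ∀ y z : X, G (T^[n] x) (T^[n] y) (T^[n] z) ≤ lam * G x y z) :
    (∀ m : ℕ, 1 ≤ m → G x (T^[m] x) (T^[m] x) ≤
      ((Finset.Icc 1 n).sup' (Finset.nonempty_Icc.mpr hn)
        (fun i => G x (T^[i] x) (T^[i] x))) / (1 - lam)) ∧
    BddAbove {r : ℝ | ∃ m : ℕ, 1 ≤ m ∧ r = G x (T^[m] x) (T^[m] x)} := by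
  obtain ⟨hnonneg, -, -, -, -, -, htri⟩ := hG
  set l := (Finset.Icc 1 n).sup' (Finset.nonempty_Icc.mpr hn)
    (fun i => G x (T^[i] x) (T^[i] x))
  have hle : ∀ i, 1 ≤ i → i ≤ n → G x (T^[i] x) (T^[i] x) ≤ l := fun i h1 h2 =>
    Finset.le_sup' (fun i => G x (T^[i] x) (T^[i] x)) (Finset.mem_Icc.mpr ⟨h1, h2⟩)
  have hl0 : 0 ≤ l := (hnonneg _ _ _).trans (hle n hn le_rfl)
  have hpos : 0 < 1 - lam := sub_pos.mpr hlam1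
  have hbound : ∀ m : ℕ, 1 ≤ m → G x (T^[m] x) (T^[m] x) ≤ l / (1 - lam) := by
    intro m
    induction m using Nat.strong_induction_on with
    | _ m ih =>
      intro hm
      rcases le_or_gt m n with hmn | hmn
      · exact (hle m hm hmn).trans (le_div_self hl0 hpos (by linarith))
      · obtain ⟨k, rfl⟩ := Nat.exists_eq_add_of_lt hmn
        rw [add_assoc, Function.iterate_add_apply]
        calc G x (T^[n] (T^[k + 1] x)) (T^[n] (T^[k + 1] x))
            ≤ G x (T^[n] x) (T^[n] x) +
              G (T^[n] x) (T^[n] (T^[k + 1] x)) (T^[n] (T^[k + 1] x)) := htri _ _ _ _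
          _ ≤ l + lam * (l / (1 - lam)) :=
              add_le_add (hle n hn le_rfl) ((hnx _ _).trans
                (mul_le_mul_of_nonneg_left (ih (k + 1) (by omega) (by omega)) hlam0))
          _ = l / (1 - lam) := by
              field_simp
              ring
  refine ⟨hbound, l / (1 - lam), ?_⟩
  rintro r ⟨m, hm, rfl⟩
  exact hbound m hm
end

section
/- Let (X,G) be a G-complete G-metric space and let T : X → X be a mapping such that there exists λ ∈ [0,1) with G(T x, T y, T z) ≤ λ · G(x, y, z) for all x, y, z ∈ X. Then T has a unique fixed point ξ, and for every x_0 ∈ X the sequence of iterates (T^n x_0) G-converges to ξ. -/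
/-- Reversing the roles of two points in a G-metric costs at most a factor of two. -/
theorem IsGMetric.swap_le_s4 {X : Type*} {G : X → X → X → ℝ} (hG : IsGMetric G) (x y : X) :
    G y x x ≤ 2 * G x y y := by
  obtain ⟨-, -, -, -, hswap, hrot, htri⟩ := hG
  have h₁ := htri x y x y
  have h₂ := hrot y x x
  have h₃ := hswap x x y
  have h₄ := hrot x y y
  linarith

/-- Points with vanishing G-distance coincide. -/
theorem IsGMetric.eq_of_le_zero {X : Type*} {G : X → X → X → ℝ} (hG : IsGMetric G) {x y : X}
    (h : G x y y ≤ 0) : y = x := by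
  by_contra hne
  have hpos := hG.2.2.1 y x hne
  have hrot := hG.2.2.2.2.2.1 x y y
  linarith

/-- The iterates of a contraction contract geometrically. -/
theorem iterate_contraction_le {X : Type*} {G : X → X → X → ℝ} {T : X → X} {lam : ℝ}
    (hlam0 : 0 ≤ lam) (h : ∀ x y z : X, G (T x) (T y) (T z) ≤ lam * G x y z)
    (n : ℕ) (x y z : X) : G (T^[n] x) (T^[n] y) (T^[n] z) ≤ lam ^ n * G x y z := by
  induction n with
  | zero => simp
  | succ n ih =>
    simp only [Function.iterate_succ_apply']
    calc _ ≤ lam * G (T^[n] x) (T^[n] y) (T^[n] z) := h _ _ _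
      _ ≤ lam * (lam ^ n * G x y z) := by gcongr
      _ = lam ^ (n + 1) * G x y z := by ring

/-- The orbit of a point under a contraction stays within a bounded distance of the point. -/
theorem IsGMetric.orbit_bounded {X : Type*} {G : X → X → X → ℝ} (hG : IsGMetric G)
    {T : X → X} {lam : ℝ} (hlam0 : 0 ≤ lam) (hlam1 : lam < 1)
    (h : ∀ x y z : X, G (T x) (T y) (T z) ≤ lam * G x y z) (x : X) (m : ℕ) :
    G x (T^[m] x) (T^[m] x) ≤ G x (T x) (T x) / (1 - lam) := by
  obtain ⟨hnonneg, hzero, -, -, -, -, htri⟩ := hG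
  have hpos : 0 < 1 - lam := by linarith
  induction m with
  | zero =>
    simpa only [Function.iterate_zero, id_eq, hzero] using div_nonneg (hnonneg _ _ _) hpos.le
  | succ m ih =>
    simp only [Function.iterate_succ_apply']
    calc _ ≤ G x (T x) (T x) + G (T x) (T (T^[m] x)) (T (T^[m] x)) := htri _ _ _ _
      _ ≤ G x (T x) (T x) + lam * (G x (T x) (T x) / (1 - lam)) := by
        gcongr
        exact (h _ _ _).trans (by gcongr)
      _ = G x (T x) (T x) / (1 - lam) := by field_simp; ring

/-- The orbits of a contraction are G-Cauchy. -/
theorem IsGMetric.isGCauchy_iterate {X : Type*} {G : X → X → X → ℝ} (hG : IsGMetric G)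
    {T : X → X} {lam : ℝ} (hlam0 : 0 ≤ lam) (hlam1 : lam < 1)
    (h : ∀ x y z : X, G (T x) (T y) (T z) ≤ lam * G x y z) (x : X) :
    IsGCauchy G (fun k => T^[k] x) := by
  intro ε hε
  set C := G x (T x) (T x) / (1 - lam)
  have hC : 0 ≤ C := div_nonneg (hG.1 _ _ _) (by linarith)
  have hlim : Filter.Tendsto (fun n : ℕ => 2 * (lam ^ n * C)) Filter.atTop (nhds 0) := by
    simpa using ((tendsto_pow_atTop_nhds_zero_of_lt_one hlam0 hlam1).mul_const C).const_mul 2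
  obtain ⟨N, hN⟩ := (hlim.eventually_lt_const hε).exists
  have key : ∀ n k : ℕ, N ≤ n →
      G (T^[n] x) (T^[n + k] x) (T^[n + k] x) ≤ lam ^ N * C := by
    intro n k hn
    rw [Function.iterate_add_apply]
    calc _ ≤ lam ^ n * G x (T^[k] x) (T^[k] x) := iterate_contraction_le hlam0 h _ _ _ _
      _ ≤ lam ^ N * C := mul_le_mul (pow_le_pow_of_le_one hlam0 hlam1.le hn)
        (hG.orbit_bounded hlam0 hlam1 h x k) (hG.1 _ _ _) (by positivity)
  have hNC : 0 ≤ lam ^ N * C := by positivity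
  refine ⟨N, fun m hm n hn => ?_⟩
  rcases le_total n m with hnm | hmn
  · obtain ⟨k, rfl⟩ := Nat.exists_eq_add_of_le hnm
    linarith [key n k hn]
  · obtain ⟨k, rfl⟩ := Nat.exists_eq_add_of_le hmn
    linarith [key m k hm, hG.swap_le_s4 (T^[m] x) (T^[m + k] x)]

/-- A G-limit of an orbit of a contraction is a fixed point. -/
theorem IsGMetric.fixed_of_gConvergesTo {X : Type*} {G : X → X → X → ℝ} (hG : IsGMetric G)
    {T : X → X} {lam : ℝ} (hlam0 : 0 ≤ lam)
    (h : ∀ x y z : X, G (T x) (T y) (T z) ≤ lam * G x y z) {x ξ : X}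
    (hξ : GConvergesTo G (fun k => T^[k] x) ξ) : T ξ = ξ := by
  have hsucc := hξ.comp (Filter.tendsto_add_atTop_nat 1)
  have hlim := hsucc.add (hξ.const_mul (lam * 2))
  rw [mul_zero, add_zero] at hlim
  refine hG.eq_of_le_zero (ge_of_tendsto' hlim fun n => ?_)
  simp only [Function.comp_apply, Function.iterate_succ_apply']
  calc _ ≤ G ξ (T (T^[n] x)) (T (T^[n] x)) + G (T (T^[n] x)) (T ξ) (T ξ) :=
        hG.2.2.2.2.2.2 _ _ _ _
    _ ≤ G ξ (T (T^[n] x)) (T (T^[n] x)) + lam * (2 * G ξ (T^[n] x) (T^[n] x)) := by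
      gcongr
      exact (h _ _ _).trans (mul_le_mul_of_nonneg_left (hG.swap_le_s4 _ _) hlam0)
    _ = _ := by ring

/-- **Theorem (Mustafa's Banach contraction principle in G-metric spaces).**
If `(X,G)` is a G-complete G-metric space and `G(Tx,Ty,Tz) ≤ λ · G(x,y,z)` for some
`λ ∈ [0,1)` and all `x,y,z`, then `T` has a unique fixed point `ξ`, and all Picard
iterates G-converge to `ξ`. -/
theorem gmetric_banach_contraction {X : Type*} [Nonempty X]
    (G : X → X → X → ℝ) (hG : IsGMetric G) (hcomp : IsGComplete G)
    (T : X → X) (lam : ℝ) (hlam0 : 0 ≤ lam) (hlam1 : lam < 1)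
    (h : ∀ x y z : X, G (T x) (T y) (T z) ≤ lam * G x y z) :
    ∃ ξ : X, T ξ = ξ ∧ (∀ η : X, T η = η → η = ξ) ∧
      ∀ x0 : X, GConvergesTo G (fun k => T^[k] x0) ξ := by
  obtain ⟨x⟩ := ‹Nonempty X›
  obtain ⟨ξ, hξ⟩ := hcomp _ (hG.isGCauchy_iterate hlam0 hlam1 h x)
  have hfix := hG.fixed_of_gConvergesTo hlam0 h hξ
  refine ⟨ξ, hfix, fun η hη => hG.eq_of_le_zero ?_, fun x0 => ?_⟩
  · have hle := h ξ η η
    rw [hfix, hη] at hle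
    nlinarith [hG.1 ξ η η]
  · have hlim : Filter.Tendsto (fun n : ℕ => lam ^ n * G ξ x0 x0) Filter.atTop (nhds 0) := by
      simpa using (tendsto_pow_atTop_nhds_zero_of_lt_one hlam0 hlam1).mul_const (G ξ x0 x0)
    refine squeeze_zero (fun n => hG.1 _ _ _) (fun n => ?_) hlim
    simpa only [Function.iterate_fixed hfix] using iterate_contraction_le hlam0 h n ξ x0 x0
end

section
/- Let X = [0,1] and define T : X → X by T(0) = 0 and, for each integer n ≥ 1 and x in the interval I_n = [1/2^n, 1/2^{n−1}]: T(x) = 1/2^{n+1} if x ∈ [1/2^n, (3n+5)/(2^{n+1}(n+2))], and T(x) = ((n+2)/(n+3))·(x − 1/2^{n−1}) + 1/2^n if x ∈ [(3n+5)/(2^{n+1}(n+2)), 1/2^{n−1}]. Then for every n ≥ 1, every x ∈ I_n, and every y ∈ [0,1], |T x − T y| ≤ ((n+3)/(n+4))·|x − y|. -/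
open Classical in
/-- The map `T : [0,1] → [0,1]` of the example (extended by `0` outside `(0,1]`).
For `x` in the interval `I_n = [1/2^n, 1/2^(n-1)]` (`n ≥ 1`) it is given piecewise by
`T x = 1/2^(n+1)` for `x ∈ [1/2^n, (3n+5)/(2^(n+1)(n+2))]` and
`T x = ((n+2)/(n+3))·(x - 1/2^(n-1)) + 1/2^n` for
`x ∈ [(3n+5)/(2^(n+1)(n+2)), 1/2^(n-1)]`; the two formulas are consistent on all
overlaps of the intervals `I_n`. Here `Nat.find` picks, for `0 < x ≤ 1`, the least
`n` with `1/2^n < x`, so that `x ∈ (1/2^n, 1/2^(n-1)] ⊆ I_n`. -/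
noncomputable def Tmap (x : ℝ) : ℝ :=
  if hx : 0 < x ∧ x ≤ 1 then
    let n : ℕ := Nat.find (exists_pow_lt_of_lt_one hx.1 (by norm_num : (1 / 2 : ℝ) < 1))
    if x ≤ (3 * (n : ℝ) + 5) / (2 ^ (n + 1) * ((n : ℝ) + 2)) then 1 / 2 ^ (n + 1)
    else (((n : ℝ) + 2) / ((n : ℝ) + 3)) * (x - 1 / 2 ^ (n - 1)) + 1 / 2 ^ n
  else 0

theorem two_mul_one_div_two_pow {m : ℕ} (hm : 1 ≤ m) :
    2 * ((1 : ℝ) / 2 ^ m) = 1 / 2 ^ (m - 1) := by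
  obtain ⟨k, rfl⟩ := Nat.exists_eq_add_of_le' hm
  rw [Nat.add_sub_cancel, pow_succ]
  field_simp

theorem one_div_two_pow_succ (m : ℕ) : (1 : ℝ) / 2 ^ (m + 1) = 1 / 2 ^ m / 2 := by
  rw [pow_succ, div_div]

theorem exists_dyadic_interval {x : ℝ} (hx : 0 < x) (hx1 : x ≤ 1) :
    ∃ m : ℕ, 1 ≤ m ∧ (1 : ℝ) / 2 ^ m < x ∧ x ≤ 2 * (1 / 2 ^ m) := by
  obtain ⟨k, hk, hk'⟩ := exists_nat_pow_near_of_lt_one hx hx1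
    (by norm_num : (0 : ℝ) < 1 / 2) (by norm_num)
  rw [one_div_pow] at hk hk'
  refine ⟨k + 1, by omega, hk, ?_⟩
  rwa [two_mul_one_div_two_pow (by omega), Nat.add_sub_cancel]

theorem Tmap_zero : Tmap 0 = 0 := by simp [Tmap]

/-- On `(1/2^m, 1/2^(m-1)]`, the map `Tmap` is the maximum of its two affine pieces. -/
theorem Tmap_eq_max_of_lt {m : ℕ} (hm : 1 ≤ m) {x : ℝ} (h1 : (1 : ℝ) / 2 ^ m < x)
    (h2 : x ≤ 2 * (1 / 2 ^ m)) :
    Tmap x = max ((1 : ℝ) / 2 ^ m / 2)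
      ((m + 2) / (m + 3) * (x - 2 * (1 / 2 ^ m)) + 1 / 2 ^ m) := by
  have hu : (0 : ℝ) < 1 / 2 ^ m := by positivity
  have hx : 0 < x := hu.trans h1
  have hx1 : x ≤ 1 := by
    rw [two_mul_one_div_two_pow hm] at h2
    refine h2.trans ?_
    rw [← one_div_pow]
    exact pow_le_one₀ (by norm_num) (by norm_num)
  have hfind : Nat.find (exists_pow_lt_of_lt_one hx (by norm_num : (1 / 2 : ℝ) < 1)) = m := by
    rw [Nat.find_eq_iff]
    refine ⟨by rwa [one_div_pow], fun k hk => not_lt.2 ?_⟩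
    rw [two_mul_one_div_two_pow hm, ← one_div_pow] at h2
    exact h2.trans (pow_le_pow_of_le_one (by norm_num) (by norm_num) (by omega))
  have hkink : (3 * (m : ℝ) + 5) / (2 ^ (m + 1) * (m + 2))
      = 2 * (1 / 2 ^ m) - (1 / 2 ^ m / 2) * ((m + 3) / (m + 2)) := by
    rw [pow_succ]
    field_simp
    ring
  have hslope : ∀ t : ℝ, t = (m + 2) / (m + 3) * (t * ((m + 3) / (m + 2))) := by
    intro t
    field_simp
  have hs : (0 : ℝ) ≤ (m + 2) / (m + 3) := by positivity
  unfold Tmap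
  rw [dif_pos ⟨hx, hx1⟩]
  convert_to (if x ≤ (3 * (m : ℝ) + 5) / (2 ^ (m + 1) * (m + 2)) then (1 : ℝ) / 2 ^ (m + 1)
    else (m + 2) / (m + 3) * (x - 1 / 2 ^ (m - 1)) + 1 / 2 ^ m) = _
  · simp only [← hfind]
  rw [hkink, one_div_two_pow_succ, ← two_mul_one_div_two_pow hm]
  generalize (1 : ℝ) / 2 ^ m = u at *
  have := hslope (u / 2)
  split_ifs with h
  · rw [max_eq_left]
    have := mul_le_mul_of_nonneg_left h hs
    linarith
  · rw [max_eq_right]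
    have := mul_le_mul_of_nonneg_left (not_le.1 h).le hs
    linarith

theorem Tmap_eq_max {m : ℕ} (hm : 1 ≤ m) {x : ℝ} (h1 : (1 : ℝ) / 2 ^ m ≤ x)
    (h2 : x ≤ 2 * (1 / 2 ^ m)) :
    Tmap x = max ((1 : ℝ) / 2 ^ m / 2)
      ((m + 2) / (m + 3) * (x - 2 * (1 / 2 ^ m)) + 1 / 2 ^ m) := by
  rcases h1.eq_or_lt with rfl | h1
  · have hu : (0 : ℝ) < 1 / 2 ^ m := by positivity
    have hs : (1 : ℝ) / 2 ≤ (m + 2) / (m + 3) := by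
      rw [div_le_div_iff₀ (by norm_num) (by positivity)]
      linarith [(Nat.cast_nonneg m : (0 : ℝ) ≤ m)]
    rw [Tmap_eq_max_of_lt (m := m + 1) (by omega) (by rw [one_div_two_pow_succ]; linarith)
      (by rw [one_div_two_pow_succ]; linarith), one_div_two_pow_succ]
    generalize (1 : ℝ) / 2 ^ m = u at *
    rw [max_eq_left (b := _ / _ * (u - 2 * u) + u) (by nlinarith), max_eq_right]
    · ring
    · ring_nf
      linarith
  · exact Tmap_eq_max_of_lt hm h1 h2

theorem Tmap_two_mul_one_div_two_pow {m : ℕ} (hm : 1 ≤ m) :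
    Tmap (2 * (1 / 2 ^ m)) = 1 / 2 ^ m := by
  have hu : (0 : ℝ) < 1 / 2 ^ m := by positivity
  rw [Tmap_eq_max hm (by linarith) le_rfl, max_eq_right] <;> simp

/-- Within one dyadic interval `Tmap` is monotone and Lipschitz with the slope of its
increasing piece. -/
theorem Tmap_sub_mem_Icc {m : ℕ} (hm : 1 ≤ m) {x y : ℝ} (h1 : (1 : ℝ) / 2 ^ m ≤ x)
    (hxy : x ≤ y) (h2 : y ≤ 2 * (1 / 2 ^ m)) :
    Tmap y - Tmap x ∈ Set.Icc 0 (((m : ℝ) + 2) / (m + 3) * (y - x)) := by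
  rw [Tmap_eq_max hm h1 (hxy.trans h2), Tmap_eq_max hm (h1.trans hxy) h2]
  have hs : (0 : ℝ) ≤ (m + 2) / (m + 3) := by positivity
  generalize (1 : ℝ) / 2 ^ m = u at *
  generalize ((m : ℝ) + 2) / (m + 3) = s at *
  have h := mul_le_mul_of_nonneg_left hxy hs
  constructor
  · rw [sub_nonneg]
    exact max_le_max_left _ (by linarith)
  · rw [sub_le_iff_le_add]
    refine max_le ?_ ?_
    · linarith [le_max_left (u / 2) (s * (x - 2 * u) + u)]
    · linarith [le_max_right (u / 2) (s * (x - 2 * u) + u)]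

theorem add_two_div_add_three_mono {a b : ℝ} (ha : 0 ≤ a) (hab : a ≤ b) :
    (a + 2) / (a + 3) ≤ (b + 2) / (b + 3) := by
  rw [div_le_div_iff₀ (by linarith) (by linarith)]
  nlinarith

/-- The increment of `Tmap` from any `x ≤ y` to a point `y` of the `m`-th dyadic interval. -/
theorem Tmap_sub_mem_Icc_of_le {m : ℕ} (hm : 1 ≤ m) {x y : ℝ} (hx : 0 ≤ x) (hxy : x ≤ y)
    (h1 : (1 : ℝ) / 2 ^ m ≤ y) (h2 : y ≤ 2 * (1 / 2 ^ m)) :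
    Tmap y - Tmap x ∈ Set.Icc 0 (((m : ℝ) + 3) / (m + 4) * (y - x)) := by
  have hu : (0 : ℝ) < 1 / 2 ^ m := by positivity
  have hm' : (1 : ℝ) ≤ m := by exact_mod_cast hm
  have hst : ((m : ℝ) + 2) / (m + 3) ≤ (m + 3) / (m + 4) := by
    convert add_two_div_add_three_mono (by linarith : (0 : ℝ) ≤ m)
      (by linarith : (m : ℝ) ≤ m + 1)
      using 2 <;> ring
  have ht : (4 : ℝ) / 5 ≤ (m + 3) / (m + 4) := by
    rw [div_le_div_iff₀ (by norm_num) (by linarith)]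
    linarith
  rcases le_total (1 / 2 ^ m) x with hmx | hxm
  · have h := Tmap_sub_mem_Icc hm hmx hxy h2
    exact ⟨h.1, h.2.trans (mul_le_mul_of_nonneg_right hst (by linarith))⟩
  have hT : Tmap (1 / 2 ^ m) = 1 / 2 ^ m / 2 := by
    have h := Tmap_two_mul_one_div_two_pow (m := m + 1) (by omega)
    rw [one_div_two_pow_succ] at h
    rw [← h]
    congr 1
    ring
  obtain ⟨hy0, hys⟩ := Tmap_sub_mem_Icc hm le_rfl h1 h2
  have hyt := hys.trans (mul_le_mul_of_nonneg_right hst (by linarith))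
  rw [hT] at hy0 hyt
  suffices h : (1 : ℝ) / 2 ^ m / 2 - Tmap x ∈
      Set.Icc 0 (((m : ℝ) + 3) / (m + 4) * (1 / 2 ^ m - x)) by
    constructor <;> linarith [h.1, h.2]
  rcases hx.eq_or_lt with rfl | hx0
  · rw [Tmap_zero]
    constructor <;> nlinarith
  have hu1 : (1 : ℝ) / 2 ^ m ≤ 1 := by
    rw [← one_div_pow]
    exact pow_le_one₀ (by norm_num) (by norm_num)
  obtain ⟨k, hk, hk1, hk2⟩ := exists_dyadic_interval hx0 (hxm.trans hu1)
  have hmk : m < k := by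
    by_contra! hkm
    have : (1 : ℝ) / 2 ^ m ≤ 1 / 2 ^ k :=
      one_div_le_one_div_of_le (by positivity) (pow_le_pow_right₀ (by norm_num) hkm)
    linarith
  obtain ⟨h0, hs⟩ := Tmap_sub_mem_Icc hk hk1.le hk2 le_rfl
  rw [Tmap_two_mul_one_div_two_pow hk] at h0 hs
  rcases (Nat.succ_le_of_lt hmk).eq_or_lt with rfl | hmk
  · rw [Nat.succ_eq_add_one, one_div_two_pow_succ] at h0 hs
    have e : (((m + 1 : ℕ) : ℝ) + 2) / ((m + 1 : ℕ) + 3) = (m + 3) / (m + 4) := by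
      push_cast
      ring
    rw [e] at hs
    rw [show 2 * ((1 : ℝ) / 2 ^ m / 2) = 1 / 2 ^ m by ring] at hs
    exact ⟨h0, hs⟩
  · have hv : (1 : ℝ) / 2 ^ k ≤ 1 / 2 ^ m / 2 / 2 := by
      rw [← one_div_two_pow_succ, ← one_div_two_pow_succ]
      exact one_div_le_one_div_of_le (by positivity) (pow_le_pow_right₀ (by norm_num) hmk)
    have hs1 : ((k : ℝ) + 2) / (k + 3) ≤ 1 := by
      rw [div_le_one (by positivity)]
      linarith
    have hs' := hs.trans (mul_le_mul_of_nonneg_right hs1 (by linarith))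
    have ht' := mul_le_mul_of_nonneg_right ht (sub_nonneg.2 hxm)
    constructor <;> linarith

/-- **Example (local Lipschitz estimate).** For every `n ≥ 1`, every
`x ∈ I_n = [1/2^n, 1/2^(n-1)]` and every `y ∈ [0,1]`,
`|T x - T y| ≤ ((n+3)/(n+4))·|x - y|`. -/
theorem Tmap_local_lipschitz :
    ∀ n : ℕ, 1 ≤ n → ∀ x ∈ Set.Icc ((1 : ℝ) / 2 ^ n) ((1 : ℝ) / 2 ^ (n - 1)),
      ∀ y ∈ Set.Icc (0 : ℝ) 1,
        |Tmap x - Tmap y| ≤ (((n : ℝ) + 3) / ((n : ℝ) + 4)) * |x - y| := by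
  intro n hn x hx y hy
  rw [← two_mul_one_div_two_pow hn] at hx
  have hu : (0 : ℝ) < 1 / 2 ^ n := by positivity
  rcases le_total y x with hyx | hxy
  · obtain ⟨h0, h⟩ := Tmap_sub_mem_Icc_of_le hn hy.1 hyx hx.1 hx.2
    rwa [abs_of_nonneg h0, abs_of_nonneg (sub_nonneg.2 hyx)]
  · rw [abs_sub_comm, abs_sub_comm x]
    have hx0 : 0 < x := hu.trans_le hx.1
    obtain ⟨m, hm, h1, h2⟩ := exists_dyadic_interval (hx0.trans_le hxy) hy.2
    rcases le_or_gt m n with hmn | hnm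
    · obtain ⟨h0, h⟩ := Tmap_sub_mem_Icc_of_le hm hx0.le hxy h1.le h2
      rw [abs_of_nonneg h0, abs_of_nonneg (sub_nonneg.2 hxy)]
      refine h.trans (mul_le_mul_of_nonneg_right ?_ (sub_nonneg.2 hxy))
      have hmn' : (m : ℝ) ≤ n := by exact_mod_cast hmn
      rw [div_le_div_iff₀ (by positivity) (by positivity)]
      linarith
    · have hv : (1 : ℝ) / 2 ^ m ≤ 1 / 2 ^ n / 2 := by
        rw [← one_div_two_pow_succ]
        exact one_div_le_one_div_of_le (by positivity) (pow_le_pow_right₀ (by norm_num) hnm)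
      obtain ⟨h0, h⟩ := Tmap_sub_mem_Icc_of_le hn hx0.le hxy (hx.1.trans hxy) (by linarith)
      rwa [abs_of_nonneg h0, abs_of_nonneg (sub_nonneg.2 hxy)]
end

section
/- Let X = [0,1] and define T : X → X by T(0) = 0 and, for each integer n ≥ 1 and x in the interval I_n = [1/2^n, 1/2^{n−1}]: T(x) = 1/2^{n+1} if x ∈ [1/2^n, (3n+5)/(2^{n+1}(n+2))], and T(x) = ((n+2)/(n+3))·(x − 1/2^{n−1}) + 1/2^n if x ∈ [(3n+5)/(2^{n+1}(n+2)), 1/2^{n−1}]. Then T is not a contraction: for every λ ∈ [0,1) there exist x, y ∈ [0,1] with |T x − T y| > λ·|x − y|. -/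
/-- On the half-open dyadic interval `(1/2^(m+1), 1/2^m]`, the index chosen in `Tmap` is `m + 1`. -/
theorem Tmap_eq_of_mem_dyadic {m : ℕ} {x : ℝ} (hlo : (1 / 2 : ℝ) ^ (m + 1) < x)
    (hhi : x ≤ (1 / 2 : ℝ) ^ m) :
    Tmap x =
      if x ≤ (3 * ((m + 1 : ℕ) : ℝ) + 5) / (2 ^ (m + 1 + 1) * (((m + 1 : ℕ) : ℝ) + 2)) then
        1 / 2 ^ (m + 1 + 1)
      else ((((m + 1 : ℕ) : ℝ) + 2) / (((m + 1 : ℕ) : ℝ) + 3)) * (x - 1 / 2 ^ m)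
        + 1 / 2 ^ (m + 1) := by
  have hx0 : 0 < x := lt_trans (by positivity) hlo
  have hx1 : x ≤ 1 := hhi.trans (pow_le_one₀ (by norm_num) (by norm_num))
  have hfind : Nat.find (exists_pow_lt_of_lt_one hx0 (by norm_num : (1 / 2 : ℝ) < 1)) = m + 1 := by
    rw [Nat.find_eq_iff]
    refine ⟨hlo, fun k hk => not_lt.mpr (hhi.trans ?_)⟩
    exact pow_le_pow_of_le_one (by norm_num) (by norm_num) (by omega)
  unfold Tmap
  rw [dif_pos ⟨hx0, hx1⟩]
  simp only [hfind, Nat.add_sub_cancel]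

/-- At the right endpoint of a dyadic interval, `Tmap` halves its argument. -/
theorem Tmap_half_pow (m : ℕ) : Tmap ((1 / 2) ^ m) = (1 / 2) ^ (m + 1) := by
  have hp : (0 : ℝ) < 2 ^ m := by positivity
  rw [Tmap_eq_of_mem_dyadic (pow_lt_pow_right_of_lt_one₀ (by norm_num) (by norm_num)
    (Nat.lt_succ_self m)) le_rfl, if_neg]
  · simp
  · rw [not_le, one_div_pow, div_lt_div_iff₀ (by positivity) hp]
    push_cast
    ring_nf
    nlinarith [mul_nonneg hp.le (Nat.cast_nonneg (α := ℝ) m)]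

/-- The value of `Tmap` at the breakpoint between its constant and affine pieces. -/
theorem Tmap_breakpoint (m : ℕ) :
    Tmap ((3 * (m : ℝ) + 8) / (2 ^ (m + 2) * ((m : ℝ) + 3))) = (1 / 2) ^ (m + 2) := by
  have hp : (0 : ℝ) < 2 ^ m := by positivity
  have hm : (0 : ℝ) ≤ m := Nat.cast_nonneg m
  rw [Tmap_eq_of_mem_dyadic (m := m), if_pos]
  · simp
  · apply le_of_eq
    push_cast
    ring_nf
  · rw [one_div_pow, div_lt_div_iff₀ (by positivity) (by positivity)]
    ring_nf
    nlinarith [mul_nonneg hp.le hm]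
  · rw [one_div_pow, div_le_div_iff₀ (by positivity) (by positivity)]
    ring_nf
    nlinarith [mul_nonneg hp.le hm]

/-- **Example.** `T` is not a contraction on `[0,1]`: for every `λ ∈ [0,1)` there
exist `x, y ∈ [0,1]` with `|T x - T y| > λ·|x - y|`. -/
theorem Tmap_not_contraction :
    ∀ lam : ℝ, 0 ≤ lam → lam < 1 →
      ∃ x ∈ Set.Icc (0 : ℝ) 1, ∃ y ∈ Set.Icc (0 : ℝ) 1,
        lam * |x - y| < |Tmap x - Tmap y| := by
  intro lam _ hlam
  obtain ⟨m, hm⟩ := exists_nat_one_div_lt (sub_pos.mpr hlam)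
  have hm0 : (0 : ℝ) ≤ m := Nat.cast_nonneg m
  have hp : (0 : ℝ) < 2 ^ m := by positivity
  have hp1 : (1 : ℝ) ≤ 2 ^ m := one_le_pow₀ (by norm_num)
  have hslope : lam * (m + 4) < m + 3 := by
    rw [div_lt_iff₀ (by positivity)] at hm
    linarith
  have hdist : (1 / 2 : ℝ) ^ m - (3 * (m : ℝ) + 8) / (2 ^ (m + 2) * ((m : ℝ) + 3))
      = (m + 4) / (2 ^ (m + 2) * ((m : ℝ) + 3)) := by
    rw [one_div_pow]
    field_simp
    ring
  have himage : (1 / 2 : ℝ) ^ (m + 1) - (1 / 2) ^ (m + 2) = 1 / 2 ^ (m + 2) := by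
    rw [one_div_pow, one_div_pow]
    field_simp
    ring
  refine ⟨(1 / 2) ^ m, ⟨by positivity, pow_le_one₀ (by norm_num) (by norm_num)⟩,
    (3 * (m : ℝ) + 8) / (2 ^ (m + 2) * ((m : ℝ) + 3)), ⟨by positivity, ?_⟩, ?_⟩
  · rw [div_le_one (by positivity), pow_add]
    nlinarith
  · rw [Tmap_half_pow, Tmap_breakpoint, hdist, himage, abs_of_pos (by positivity),
      abs_of_pos (by positivity), ← mul_div_assoc, div_lt_div_iff₀ (by positivity) (by positivity)]
    nlinarith [mul_lt_mul_of_pos_right hslope (by positivity : (0 : ℝ) < 2 ^ (m + 2))]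
end

section
/- Let (X,G) be a G-metric space, T : X → X a mapping, and B ⊆ X a subset with T(B) ⊆ B. Suppose there exist u ∈ B, a positive integer n(u) with T^{n(u)} u = u, and λ ∈ [0,1) such that G(T^{n(u)} u, T^{n(u)} x, T^{n(u)} y) ≤ λ · G(u, x, y) for all x, y ∈ B. Then u is the unique fixed point of T in B, and for every x_0 ∈ B the sequence of iterates (T^n x_0)_{n ≥ 1} G-converges to u. -/
/-- A nonnegative real sequence that contracts by a factor `c < 1` along every shift by `n > 0`
tends to zero. -/
theorem tendsto_zero_of_shift_le_mul {a : ℕ → ℝ} {c : ℝ} {n : ℕ} (hn : 0 < n)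
    (hc0 : 0 ≤ c) (hc1 : c < 1) (ha : ∀ k, 0 ≤ a k) (hstep : ∀ k, a (k + n) ≤ c * a k) :
    Filter.Tendsto a Filter.atTop (nhds 0) := by
  have hpow : ∀ q r, a (r + n * q) ≤ c ^ q * a r := by
    intro q r
    induction q with
    | zero => simp
    | succ q ih =>
      calc a (r + n * (q + 1)) = a (r + n * q + n) := by rw [mul_add, mul_one, add_assoc]
        _ ≤ c * a (r + n * q) := hstep _
        _ ≤ c * (c ^ q * a r) := mul_le_mul_of_nonneg_left ih hc0
        _ = c ^ (q + 1) * a r := by ring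
  have hbound : ∀ k, a k ≤ c ^ (k / n) * ∑ i ∈ Finset.range n, a i := by
    intro k
    calc a k = a (k % n + n * (k / n)) := by rw [Nat.mod_add_div]
      _ ≤ c ^ (k / n) * a (k % n) := hpow _ _
      _ ≤ _ := mul_le_mul_of_nonneg_left
        (Finset.single_le_sum (fun i _ => ha i) (Finset.mem_range.2 (Nat.mod_lt k hn)))
        (pow_nonneg hc0 _)
  refine squeeze_zero ha hbound ?_
  simpa using ((tendsto_pow_atTop_nhds_zero_of_lt_one hc0 hc1).comp
    (Nat.tendsto_div_const_atTop hn.ne')).mul_const (∑ i ∈ Finset.range n, a i)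

/-- **Lemma.** Let `B ⊆ X` with `T(B) ⊆ B`. If some `u ∈ B` and positive integer
`n = n(u)` satisfy `T^[n] u = u` and `G(T^[n] u, T^[n] x, T^[n] y) ≤ λ · G(u,x,y)`
for all `x, y ∈ B` (with `λ ∈ [0,1)`), then `u` is the unique fixed point of `T` in
`B` and the iterates `(T^k x₀)_{k ≥ 1}` G-converge to `u` for every `x₀ ∈ B`. -/
theorem gmetric_local_power_contraction_fixed_point {X : Type*}
    (G : X → X → X → ℝ) (hG : IsGMetric G)
    (T : X → X) (B : Set X) (hTB : Set.MapsTo T B B)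
    (u : X) (hu : u ∈ B) (n : ℕ) (hn : 0 < n) (hfix : T^[n] u = u)
    (lam : ℝ) (hlam0 : 0 ≤ lam) (hlam1 : lam < 1)
    (h : ∀ x ∈ B, ∀ y ∈ B, G (T^[n] u) (T^[n] x) (T^[n] y) ≤ lam * G u x y) :
    T u = u ∧ (∀ v ∈ B, T v = v → v = u) ∧
      ∀ x0 ∈ B, GConvergesTo G (fun k => T^[k + 1] x0) u := by
  obtain ⟨hnonneg, -, hpos, -, -, hrot, -⟩ := hG
  rw [hfix] at h
  have huniq : ∀ v ∈ B, T^[n] v = v → v = u := by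
    intro v hv hvfix
    by_contra hne
    have hlt : 0 < G u v v := hrot u v v ▸ hpos v u hne
    have hle := h v hv v hv
    rw [hvfix] at hle
    nlinarith
  refine ⟨huniq _ (hTB hu) ?_, fun v hv hTv => huniq v hv (Function.iterate_fixed hTv n), ?_⟩
  · rw [← Function.iterate_succ_apply, Function.iterate_succ_apply', hfix]
  · intro x0 hx0
    refine tendsto_zero_of_shift_le_mul hn hlam0 hlam1 (fun k => hnonneg _ _ _) fun k => ?_
    have hmem : T^[k + 1] x0 ∈ B := hTB.iterate (k + 1) hx0
    have hshift : T^[k + n + 1] x0 = T^[n] (T^[k + 1] x0) := by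
      rw [← Function.iterate_add_apply, add_comm k n, add_assoc]
    simpa only [hshift] using h _ hmem _ hmem
end

section
/- Let (X,G) be a G-complete G-metric space and T : X → X a mapping satisfying, for a subset B ⊆ X: (i) T(B) ⊆ B; (ii) there exists λ ∈ (0,1) such that for each x ∈ B there is a positive integer n(x) ≥ 1 with G(T^{n(x)} x, T^{n(x)} y, T^{n(x)} z) ≤ λ · G(x, y, z) for all y, z ∈ B; (iii) for some x_0 ∈ B the closure (in the topology generated by G) of {T^n x_0 : n ≥ 1} is contained in B; let ξ ∈ B be the resulting fixed point of T in B. If moreover G(T^{n(ξ)} ξ, T^{n(ξ)} x, T^{n(ξ)} y) ≤ λ · G(ξ, x, y) for all x, y ∈ X, then ξ is the unique fixed point of T in all of X, and for any x_0 ∈ X the sequence of iterates (T^n x_0)_{n ≥ 1} G-converges to ξ. -/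
/-- A nonnegative sequence that contracts by a factor `r < 1` every `n` steps tends to `0`. -/
theorem tendsto_zero_of_add_le_mul {f : ℕ → ℝ} {r : ℝ} {n : ℕ} (hf : ∀ k, 0 ≤ f k)
    (hr0 : 0 ≤ r) (hr1 : r < 1) (hn : 1 ≤ n) (h : ∀ k, f (k + n) ≤ r * f k) :
    Filter.Tendsto f Filter.atTop (nhds 0) := by
  have hpow : ∀ q k, f (k + n * q) ≤ r ^ q * f k := by
    intro q k
    induction q with
    | zero => simp
    | succ q ih =>
      calc f (k + n * (q + 1)) = f (k + n * q + n) := by rw [mul_add_one, add_assoc]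
        _ ≤ r * f (k + n * q) := h _
        _ ≤ r * (r ^ q * f k) := mul_le_mul_of_nonneg_left ih hr0
        _ = r ^ (q + 1) * f k := by ring
  have hbound : ∀ k, f k ≤ r ^ (k / n) * ∑ i ∈ Finset.range n, f i := by
    intro k
    calc f k = f (k % n + n * (k / n)) := by rw [Nat.mod_add_div]
      _ ≤ r ^ (k / n) * f (k % n) := hpow _ _
      _ ≤ r ^ (k / n) * ∑ i ∈ Finset.range n, f i :=
        mul_le_mul_of_nonneg_left
          (Finset.single_le_sum (fun i _ => hf i) (Finset.mem_range.2 (Nat.mod_lt k hn)))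
          (pow_nonneg hr0 _)
  have hlim := ((tendsto_pow_atTop_nhds_zero_of_lt_one hr0 hr1).comp
    (Nat.tendsto_div_const_atTop (Nat.one_le_iff_ne_zero.1 hn))).mul_const
      (∑ i ∈ Finset.range n, f i)
  rw [zero_mul] at hlim
  exact squeeze_zero hf hbound hlim

/-- **Corollary.** Under the hypotheses of the subset power-contraction theorem, let
`ξ ∈ B` be the resulting fixed point of `T` in `B`. If moreover
`G(T^[n ξ] ξ, T^[n ξ] x, T^[n ξ] y) ≤ λ · G(ξ,x,y)` for all `x, y ∈ X`, then `ξ` is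
the unique fixed point of `T` in all of `X`, and the iterates `(T^k y₀)_{k ≥ 1}`
G-converge to `ξ` for every `y₀ ∈ X`. -/
theorem gmetric_power_contraction_on_subset_global {X : Type*} [Nonempty X]
    (G : X → X → X → ℝ) (hG : IsGMetric G) (hcomp : IsGComplete G)
    (T : X → X) (B : Set X) (hTB : Set.MapsTo T B B)
    (lam : ℝ) (hlam0 : 0 < lam) (hlam1 : lam < 1)
    (h : ∀ x ∈ B, ∃ n : ℕ, 1 ≤ n ∧ ∀ y ∈ B, ∀ z ∈ B,
      G (T^[n] x) (T^[n] y) (T^[n] z) ≤ lam * G x y z)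
    (x0 : X) (hx0 : x0 ∈ B)
    (hcl : ∀ p : X, (∃ s : ℕ → X, (∀ j, ∃ m : ℕ, 1 ≤ m ∧ s j = T^[m] x0) ∧
      GConvergesTo G s p) → p ∈ B)
    (ξ : X) (hξB : ξ ∈ B) (hξfix : T ξ = ξ)
    (hstrong : ∃ n : ℕ, 1 ≤ n ∧
      ∀ x y : X, G (T^[n] ξ) (T^[n] x) (T^[n] y) ≤ lam * G ξ x y) :
    T ξ = ξ ∧ (∀ η : X, T η = η → η = ξ) ∧
      ∀ y0 : X, GConvergesTo G (fun k => T^[k + 1] y0) ξ := by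
  obtain ⟨hnonneg, -, hpos, -, -, hcyc, -⟩ := hG
  obtain ⟨n, hn, hcontr⟩ := hstrong
  simp only [Function.iterate_fixed hξfix] at hcontr
  refine ⟨hξfix, fun η hη => ?_, fun y0 => ?_⟩
  · by_contra hne
    have hle := hcontr η η
    rw [Function.iterate_fixed hη, hcyc] at hle
    nlinarith [hpos η ξ hne]
  · refine (Filter.tendsto_add_atTop_iff_nat
      (f := fun k => G ξ (T^[k] y0) (T^[k] y0)) 1).2 ?_
    refine tendsto_zero_of_add_le_mul (fun _ => hnonneg _ _ _) hlam0.le hlam1 hn fun k => ?_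
    rw [add_comm k n, Function.iterate_add_apply]
    exact hcontr _ _
end

section
/- Let T_1, T_2, T_3 be self-mappings of a G-metric space (X,G) satisfying: there exists λ ∈ (0,1) such that for each x, y, z ∈ X there exist positive integers n(x), m(y), k(z) with G(T_1^{n(x)} x, T_2^{m(y)} y, T_3^{k(z)} z) ≤ λ · max{ G(x,y,z), G(x, T_1^{n(x)} x, T_1^{n(x)} x), G(y, T_2^{m(y)} y, T_2^{m(y)} y), G(z, T_3^{k(z)} z, T_3^{k(z)} z), (1/4)[ G(T_1^{n(x)} x, y, z) + G(x, T_2^{m(y)} y, z) + G(x, y, T_3^{k(z)} z) ] }. For x_0 ∈ X define the sequence x_{3n+1} = T_1^{n(x_{3n})} x_{3n}, x_{3n+2} = T_2^{m(x_{3n+1})} x_{3n+1}, x_{3n+3} = T_3^{k(x_{3n+2})} x_{3n+2}. If the points x_n are pairwise distinct, then G(x_n, x_{n+1}, x_{n+2}) ≤ λ^n · r(x_0) for all n, where r(x_0) = max{ G(x_0,x_1,x_2), G(x_1,x_2,x_3), G(x_2,x_3,x_4) }, and (x_n) is a G-Cauchy sequence. -/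
namespace IsGMetric

variable {X : Type*} {G : X → X → X → ℝ}

/-- If `G b c d` satisfies the contractive bound along four consecutive points `a, b, c, d`,
then it is at most `lam * G a b c`. -/
theorem le_mul_of_contractive (hG : IsGMetric G) {lam : ℝ} (hlam0 : 0 < lam) (hlam1 : lam < 1)
    {a b c d : X} (hab : a ≠ b) (hac : a ≠ c) (hbc : b ≠ c)
    (h : G b c d ≤ lam * max (G a b c) (max (G a b b) (max (G b c c) (max (G c d d)
      ((1 / 4 : ℝ) * (G b b c + G a c c + G a b d)))))) :
    G b c d ≤ lam * G a b c := by
  obtain ⟨nonneg, -, -, mono, swap, rot, tri⟩ := hG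
  have habb : G a b b ≤ G a b c := by
    linarith [mono b a c hac.symm, rot a b b, rot b b a, rot a b c, swap b a c, swap b c a]
  have hbcc : G b c c ≤ G a b c := by
    linarith [mono c b a hab, rot b c c, rot a b c, rot b c a, swap c b a, swap c a b]
  have hcdd : G c d d ≤ G b c d := by
    linarith [mono d c b hbc, rot c d d, rot b c d, rot c d b, swap d c b, swap d b c]
  have hbbc : G b b c ≤ G a b c := by
    linarith [mono b c a hac, rot a b c]
  have hacc : G a c c ≤ G a b c := by
    linarith [mono c a b hab.symm, rot a c c, rot a b c, rot b c a]
  have habd : G a b d ≤ G a b c + G b c d := by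
    linarith [tri a b d c, rot c b d, swap b d c]
  have key : G b c d ≤ lam * max (G a b c) (G b c d) := by
    refine h.trans (mul_le_mul_of_nonneg_left ?_ hlam0.le)
    have h₁ := le_max_left (G a b c) (G b c d)
    have h₂ := le_max_right (G a b c) (G b c d)
    refine max_le h₁ (max_le ?_ (max_le ?_ (max_le ?_ ?_))) <;> linarith
  rcases le_total (G b c d) (G a b c) with hle | hle
  · rwa [max_eq_left hle] at key
  · rw [max_eq_right hle] at key
    have := nonneg b c d
    have := mul_nonneg hlam0.le (nonneg a b c)
    nlinarith

/-- A sequence of distinct points whose consecutive triples have geometrically decaying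
`G`-values is G-Cauchy. -/
theorem isGCauchy_of_le_geometric (hG : IsGMetric G) {lam C : ℝ} (hlam0 : 0 < lam)
    (hlam1 : lam < 1) {s : ℕ → X} (hs : Function.Injective s)
    (h : ∀ j, G (s j) (s (j + 1)) (s (j + 2)) ≤ lam ^ j * C) : IsGCauchy G s := by
  obtain ⟨nonneg, zero, -, mono, swap, rot, tri⟩ := hG
  have hne : 1 - lam ≠ 0 := by linarith
  have hC : 0 ≤ C := by simpa using (nonneg _ _ _).trans (h 0)
  have forward (j : ℕ) : G (s j) (s (j + 1)) (s (j + 1)) ≤ lam ^ j * C := by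
    have := mono (s (j + 1)) (s j) (s (j + 2)) (hs.ne (by omega))
    linarith [h j, rot (s j) (s (j + 1)) (s (j + 1)), rot (s j) (s (j + 1)) (s (j + 2)),
      swap (s (j + 1)) (s j) (s (j + 2))]
  have backward (j : ℕ) : G (s (j + 1)) (s j) (s j) ≤ lam ^ j * C := by
    have := mono (s j) (s (j + 1)) (s (j + 2)) (hs.ne (by omega))
    linarith [h j, rot (s (j + 1)) (s j) (s j)]
  have bound (N p : ℕ) :
      G (s N) (s (N + p)) (s (N + p)) ≤ lam ^ N * C * ((1 - lam ^ p) / (1 - lam)) ∧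
      G (s (N + p)) (s N) (s N) ≤ lam ^ N * C * ((1 - lam ^ p) / (1 - lam)) := by
    induction p with
    | zero => simp [zero]
    | succ p ih =>
      have hsum : lam ^ N * C * ((1 - lam ^ (p + 1)) / (1 - lam)) =
          lam ^ N * C * ((1 - lam ^ p) / (1 - lam)) + lam ^ (N + p) * C := by
        field_simp
        ring
      rw [hsum, ← add_assoc N p 1]
      constructor
      · linarith [ih.1, forward (N + p),
          tri (s N) (s (N + p + 1)) (s (N + p + 1)) (s (N + p))]
      · linarith [ih.2, backward (N + p), tri (s (N + p + 1)) (s N) (s N) (s (N + p))]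
  have geometric_le (N p : ℕ) : lam ^ N * C * ((1 - lam ^ p) / (1 - lam)) ≤
      lam ^ N * (C / (1 - lam)) := by
    rw [mul_assoc, mul_div_assoc']
    have : 0 ≤ lam ^ p := by positivity
    have : 0 < 1 - lam := by linarith
    gcongr
    nlinarith
  intro ε hε
  have hlim : Filter.Tendsto (fun N : ℕ => lam ^ N * (C / (1 - lam))) Filter.atTop (nhds 0) := by
    simpa using (tendsto_pow_atTop_nhds_zero_of_lt_one hlam0.le hlam1).mul_const (C / (1 - lam))
  obtain ⟨N, hN⟩ := (hlim.eventually_lt_const (half_pos hε)).exists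
  refine ⟨N, fun m hm n hn => ?_⟩
  obtain ⟨p, rfl⟩ := Nat.exists_eq_add_of_le hm
  obtain ⟨q, rfl⟩ := Nat.exists_eq_add_of_le hn
  linarith [(bound N p).1, (bound N q).2, geometric_le N p, geometric_le N q,
    tri (s (N + q)) (s (N + p)) (s (N + p)) (s N)]

end IsGMetric

/-- **Lemma (Cauchyness of the mixed iterate sequence).** Under the three-map
contractive condition, the sequence `x_{3j+1} = T₁^[n x_{3j}] x_{3j}`,
`x_{3j+2} = T₂^[m x_{3j+1}] x_{3j+1}`, `x_{3j+3} = T₃^[k x_{3j+2}] x_{3j+2}`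
(with pairwise distinct terms) satisfies
`G(x_j, x_{j+1}, x_{j+2}) ≤ λ^j · r(x₀)` and is G-Cauchy, where
`r(x₀) = max{G(x₀,x₁,x₂), G(x₁,x₂,x₃), G(x₂,x₃,x₄)}`. -/
theorem gmetric_three_maps_iterates_cauchy {X : Type*}
    (G : X → X → X → ℝ) (hG : IsGMetric G)
    (T1 T2 T3 : X → X) (lam : ℝ) (hlam0 : 0 < lam) (hlam1 : lam < 1)
    (n m k : X → ℕ) (hn : ∀ x, 0 < n x) (hm : ∀ y, 0 < m y) (hk : ∀ z, 0 < k z)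
    (h : ∀ x y z : X,
      G (T1^[n x] x) (T2^[m y] y) (T3^[k z] z) ≤ lam *
        max (G x y z)
          (max (G x (T1^[n x] x) (T1^[n x] x))
            (max (G y (T2^[m y] y) (T2^[m y] y))
              (max (G z (T3^[k z] z) (T3^[k z] z))
                ((1 / 4 : ℝ) * (G (T1^[n x] x) y z + G x (T2^[m y] y) z +
                  G x y (T3^[k z] z)))))))
    (x0 : X) (seq : ℕ → X) (hseq0 : seq 0 = x0)
    (hseq1 : ∀ j, seq (3 * j + 1) = T1^[n (seq (3 * j))] (seq (3 * j)))
    (hseq2 : ∀ j, seq (3 * j + 2) = T2^[m (seq (3 * j + 1))] (seq (3 * j + 1)))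
    (hseq3 : ∀ j, seq (3 * j + 3) = T3^[k (seq (3 * j + 2))] (seq (3 * j + 2)))
    (hdist : ∀ i j : ℕ, i ≠ j → seq i ≠ seq j) :
    (∀ j : ℕ, G (seq j) (seq (j + 1)) (seq (j + 2)) ≤ lam ^ j *
      max (G (seq 0) (seq 1) (seq 2))
        (max (G (seq 1) (seq 2) (seq 3)) (G (seq 2) (seq 3) (seq 4)))) ∧
    IsGCauchy G seq := by
  have swap := hG.2.2.2.2.1
  have rot := hG.2.2.2.2.2.1
  have step (j : ℕ) : G (seq (j + 1)) (seq (j + 2)) (seq (j + 3)) ≤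
      lam * G (seq j) (seq (j + 1)) (seq (j + 2)) := by
    refine hG.le_mul_of_contractive hlam0 hlam1 (hdist _ _ (by omega)) (hdist _ _ (by omega))
      (hdist _ _ (by omega)) ?_
    obtain ⟨i, rfl | rfl | rfl⟩ : ∃ i, j = 3 * i ∨ j = 3 * i + 1 ∨ j = 3 * i + 2 :=
      ⟨j / 3, by omega⟩
    · have hc := h (seq (3 * i)) (seq (3 * i + 1)) (seq (3 * i + 2))
      rwa [← hseq1, ← hseq2, ← hseq3] at hc
    · have hc := h (seq (3 * (i + 1))) (seq (3 * i + 1)) (seq (3 * i + 2))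
      rw [← hseq1, ← hseq2, ← hseq3] at hc
      simp only [mul_add, mul_one, add_assoc, Nat.reduceAdd] at hc ⊢
      grind
    · have hc := h (seq (3 * (i + 1))) (seq (3 * (i + 1) + 1)) (seq (3 * i + 2))
      rw [← hseq1, ← hseq2, ← hseq3] at hc
      simp only [mul_add, mul_one, add_assoc, Nat.reduceAdd] at hc ⊢
      grind
  have decay (j : ℕ) : G (seq j) (seq (j + 1)) (seq (j + 2)) ≤ lam ^ j *
      max (G (seq 0) (seq 1) (seq 2))
        (max (G (seq 1) (seq 2) (seq 3)) (G (seq 2) (seq 3) (seq 4))) := by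
    induction j with
    | zero => simp
    | succ j ih =>
      rw [pow_succ', mul_assoc]
      exact (step j).trans (mul_le_mul_of_nonneg_left ih hlam0.le)
  have hinj : Function.Injective seq := fun i j hij => by
    by_contra hne
    exact hdist i j hne hij
  exact ⟨decay, hG.isGCauchy_of_le_geometric hlam0 hlam1 hinj decay⟩
end

section
/- Let (X,G) be a G-metric space, T : X → X a mapping, λ ∈ [0,1), and suppose for each x ∈ X there exists a positive integer n(x) such that G(T^{n(x)} x, T^{n(x)} y, T^{n(x)} z) ≤ λ · G(x, y, z) for all y, z ∈ X. Then for every x_0 ∈ X and every n ≥ 1, with the sequence defined by x_{i+1} = T^{n(x_i)} x_i, one has G(x_n, T x_n, T x_n) ≤ λ^n · G(x_0, T x_0, T x_0); in particular G(x_n, T x_n, T x_n) → 0 as n → ∞. -/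
/-- Under the power-contraction condition (witnessed by `N : X → ℕ`), the sequence
`x_{i+1} = T^[N x_i] x_i` satisfies
`G(x_n, T x_n, T x_n) ≤ λ^n · G(x₀, T x₀, T x₀)` for all `n ≥ 1`; in particular
`G(x_n, T x_n, T x_n) → 0`. -/
theorem gmetric_power_contraction_displacement_tendsto_zero {X : Type*}
    (G : X → X → X → ℝ) (hG : IsGMetric G)
    (T : X → X) (lam : ℝ) (hlam0 : 0 ≤ lam) (hlam1 : lam < 1)
    (N : X → ℕ) (hNpos : ∀ x, 0 < N x)
    (hN : ∀ x y z : X, G (T^[N x] x) (T^[N x] y) (T^[N x] z) ≤ lam * G x y z)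
    (x0 : X) (seq : ℕ → X) (hseq0 : seq 0 = x0)
    (hseq : ∀ i, seq (i + 1) = T^[N (seq i)] (seq i)) :
    (∀ n : ℕ, 1 ≤ n → G (seq n) (T (seq n)) (T (seq n)) ≤
      lam ^ n * G x0 (T x0) (T x0)) ∧
    Filter.Tendsto (fun n => G (seq n) (T (seq n)) (T (seq n)))
      Filter.atTop (nhds 0) := by
  have step (n : ℕ) : G (seq (n + 1)) (T (seq (n + 1))) (T (seq (n + 1))) ≤
      lam * G (seq n) (T (seq n)) (T (seq n)) := by
    rw [hseq, ← Function.iterate_succ_apply' T, Function.iterate_succ_apply]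
    exact hN _ _ _
  have bound (n : ℕ) : G (seq n) (T (seq n)) (T (seq n)) ≤ lam ^ n * G x0 (T x0) (T x0) := by
    induction n with
    | zero => simp [hseq0]
    | succ n ih =>
      calc _ ≤ lam * G (seq n) (T (seq n)) (T (seq n)) := step n
        _ ≤ lam * (lam ^ n * G x0 (T x0) (T x0)) := mul_le_mul_of_nonneg_left ih hlam0
        _ = _ := by ring
  refine ⟨fun n _ => bound n, squeeze_zero (fun n => hG.1 _ _ _) bound ?_⟩
  simpa using (tendsto_pow_atTop_nhds_zero_of_lt_one hlam0 hlam1).mul_const (G x0 (T x0) (T x0))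
end
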